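/- arXiv:1102.2493 — 2 statements merged into one kernel-verified Lean document; each statement's English description precedes it below -/
import Mathlib

section
/- Let K be an arbitrary (commutative) field and n a positive integer. If V is a linear subspace of the space M_n(K) of n×n matrices over K with a trivial spectrum, then dim V ≤ n(n-1)/2. -/
/-- A linear subspace of matrices has a trivial spectrum if no matrix of it
possesses a non-zero invariant vector. -/
def TrivialSpectrum {K : Type*} [Field K] {n : ℕ} (V : Set (Matrix (Fin n) (Fin n) K)) : Prop :=
  ∀ M ∈ V, ∀ X : Fin n → K, M.mulVec X = X → X = 0

/-- A square matrix over a finite index set without zero rows has a nonempty set `S` of indices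
such that each row indexed by `S` has exactly one nonzero entry in the columns indexed by `S`. -/
theorem exists_finset_existsUnique_ne_zero {ι K : Type*} [Fintype ι] [Nonempty ι] [Zero K]
    (R : ι → ι → K) (hR : ∀ i, R i ≠ 0) :
    ∃ S : Finset ι, S.Nonempty ∧ ∀ i ∈ S, ∃ j ∈ S, R i j ≠ 0 ∧ ∀ k ∈ S, R i k ≠ 0 → k = j := by
  classical
  obtain ⟨S, hS⟩ := exists_minimal_of_wellFoundedLT
    (fun S : Finset ι => S.Nonempty ∧ ∀ i ∈ S, ∃ j ∈ S, R i j ≠ 0)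
    ⟨Finset.univ, Finset.univ_nonempty, fun i _ => by
      obtain ⟨j, hj⟩ := Function.ne_iff.mp (hR i)
      exact ⟨j, Finset.mem_univ j, hj⟩⟩
  have image_eq (f : ι → ι) (hf : ∀ i ∈ S, f i ∈ S ∧ R i (f i) ≠ 0) : S.image f = S := by
    have hsub : S.image f ⊆ S := Finset.image_subset_iff.mpr fun i hi => (hf i hi).1
    refine hS.eq_of_le ⟨hS.prop.1.image f, fun i hi => ?_⟩ hsub
    exact ⟨f i, Finset.mem_image_of_mem f (hsub hi), (hf i (hsub hi)).2⟩
  refine ⟨S, hS.prop.1, fun i hi => ?_⟩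
  choose! f hfS hfR using hS.prop.2
  refine ⟨f i, hfS i hi, hfR i hi, fun k hk hRk => ?_⟩
  by_contra hne
  have hinj : Set.InjOn f S :=
    Finset.card_image_iff.mp (by rw [image_eq f fun i hi => ⟨hfS i hi, hfR i hi⟩])
  have himage : S.image (Function.update f i k) = S := image_eq _ fun l hl => by
    rcases eq_or_ne l i with rfl | h
    · simpa using ⟨hk, hRk⟩
    · simpa [h] using ⟨hfS l hl, hfR l hl⟩
  have hmem : f i ∈ S.image (Function.update f i k) := himage.symm ▸ hfS i hi
  obtain ⟨a, ha, hai⟩ := Finset.mem_image.mp hmem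
  rcases eq_or_ne a i with rfl | h
  · exact hne (by simpa using hai)
  · exact h (hinj ha hi (by simpa [h] using hai))

/-- For a nonempty index set, a space of matrices with trivial spectrum contains, for some `i`,
no nonzero matrix supported on row `i`. -/
theorem TrivialSpectrum.exists_row {K : Type*} [Field K] {n : ℕ} (hn : 0 < n)
    {V : Submodule K (Matrix (Fin n) (Fin n) K)}
    (hV : TrivialSpectrum (V : Set (Matrix (Fin n) (Fin n) K))) :
    ∃ i, ∀ M ∈ V, (∀ k, k ≠ i → M k = 0) → M = 0 := by
  have : Nonempty (Fin n) := ⟨⟨0, hn⟩⟩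
  by_contra! h
  choose M hMV hrow hM using h
  obtain ⟨S, hS, hS'⟩ := exists_finset_existsUnique_ne_zero (fun i => M i i) fun i hi =>
    hM i <| funext fun k => by
      rcases eq_or_ne k i with rfl | hk
      · exact hi
      · exact hrow i k hk
  choose! f hfS hfM huniq using hS'
  let X : Fin n → K := fun j => if j ∈ S then 1 else 0
  have hdot (i) (hi : i ∈ S) : (M i).mulVec X i = M i i (f i) := by
    simp only [Matrix.mulVec, dotProduct, X, mul_ite, mul_one, mul_zero, ← Finset.sum_filter]
    rw [Finset.sum_filter, Finset.sum_eq_single (f i)]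
    · simp [hfS i hi]
    · intro k _ hk
      split_ifs with hkS
      · by_contra hne
        exact hk (huniq i hi k hkS hne)
      · rfl
    · simp
  have hoff (i l) (hl : l ≠ i) : (M i).mulVec X l = 0 := by
    simp [Matrix.mulVec, hrow i l hl]
  have hfix : (∑ i ∈ S, (M i i (f i))⁻¹ • M i).mulVec X = X := by
    funext l
    rw [Matrix.sum_mulVec, Finset.sum_apply]
    simp only [Matrix.smul_mulVec, Pi.smul_apply, smul_eq_mul]
    by_cases hl : l ∈ S
    · rw [Finset.sum_eq_single l (fun i _ hi => by rw [hoff i l hi.symm, mul_zero])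
        (fun h => absurd hl h), hdot l hl, inv_mul_cancel₀ (hfM l hl)]
      simp [X, hl]
    · rw [Finset.sum_eq_zero fun i hi => by
        rw [hoff i l (fun h => hl (h ▸ hi)), mul_zero]]
      simp [X, hl]
  have hX := hV _ (V.sum_mem fun i _ => V.smul_mem _ (hMV i)) X hfix
  obtain ⟨i, hi⟩ := hS
  simpa [X, hi] using congrFun hX i

/-- If `V` has a trivial spectrum, deleting row and column `i` from the matrices of `V` with zero
column `i` gives a space with a trivial spectrum. -/
theorem TrivialSpectrum.image_submatrix {K : Type*} [Field K] {n : ℕ}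
    {V : Set (Matrix (Fin (n + 1)) (Fin (n + 1)) K)} (hV : TrivialSpectrum V) (i : Fin (n + 1)) :
    TrivialSpectrum
      (Set.image (fun M => M.submatrix i.succAbove i.succAbove) {M ∈ V | M.col i = 0}) := by
  rintro _ ⟨M, ⟨hMV, hMi⟩, rfl⟩ X hX
  have hcol (k) : M k i = 0 := congrFun hMi k
  have hY := hV M hMV (i.insertNth (∑ j, M i (i.succAbove j) * X j) X) <| by
    funext k
    simp only [Matrix.mulVec, dotProduct, Fin.sum_univ_succAbove _ i, hcol, zero_mul, zero_add,
      Fin.insertNth_apply_succAbove]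
    refine i.succAboveCases ?_ (fun k => ?_) k
    · simp
    · simpa [Matrix.mulVec, dotProduct] using congrFun hX k
  funext j
  simpa using congrFun hY (i.succAbove j)

/-- A space of `n × n` matrices with a trivial spectrum has dimension at most `n.choose 2`. -/
theorem TrivialSpectrum.finrank_le_choose {K : Type*} [Field K] {n : ℕ}
    (V : Submodule K (Matrix (Fin n) (Fin n) K))
    (hV : TrivialSpectrum (V : Set (Matrix (Fin n) (Fin n) K))) :
    Module.finrank K V ≤ n.choose 2 := by
  induction n with
  | zero => simp [Module.finrank_zero_of_subsingleton]
  | succ n ih =>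
    obtain ⟨i, hi⟩ := hV.exists_row n.succ_pos
    let column : Matrix (Fin (n + 1)) (Fin (n + 1)) K →ₗ[K] Fin (n + 1) → K :=
      { toFun := fun M => M.col i
        map_add' := fun _ _ => rfl
        map_smul' := fun _ _ => rfl }
    let minor : Matrix (Fin (n + 1)) (Fin (n + 1)) K →ₗ[K] Matrix (Fin n) (Fin n) K :=
      { toFun := fun M => M.submatrix i.succAbove i.succAbove
        map_add' := fun _ _ => rfl
        map_smul' := fun _ _ => rfl }
    have hcolumn : Module.finrank K (LinearMap.range (column.domRestrict V)) ≤ n := by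
      have hlt : LinearMap.range (column.domRestrict V) < ⊤ := by
        refine lt_top_iff_ne_top.mpr fun htop => ?_
        obtain ⟨⟨M, hMV⟩, hM⟩ :=
          LinearMap.range_eq_top.mp htop (Pi.single i 1)
        have := hV M hMV (Pi.single i 1) (by rw [Matrix.mulVec_single_one]; exact hM)
        simpa using congrFun this i
      have := Submodule.finrank_lt hlt.ne
      simp only [Module.finrank_fin_fun] at this
      omega
    let φ := (minor.domRestrict V).domRestrict (LinearMap.ker (column.domRestrict V))
    have hφ : Function.Injective φ := by
      refine (LinearMap.ker_eq_bot (M := LinearMap.ker (column.domRestrict V))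
        (M₂ := Matrix (Fin n) (Fin n) K) (f := φ)).mp (LinearMap.ker_eq_bot'.mpr ?_)
      rintro ⟨⟨M, hMV⟩, hM⟩ hminor
      have hcol (k) : M k i = 0 := congrFun (LinearMap.mem_ker.mp hM) k
      have hM0 : M = 0 := hi M hMV fun k hk => by
        obtain ⟨k, rfl⟩ := Fin.exists_succAbove_eq hk
        funext j
        refine i.succAboveCases (hcol _) (fun j => ?_) j
        exact congrFun (congrFun hminor k) j
      exact Subtype.ext (Subtype.ext hM0)
    have hminor : Module.finrank K (LinearMap.range φ) ≤ n.choose 2 := by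
      refine ih _ fun N hN => ?_
      obtain ⟨⟨⟨M, hMV⟩, hM⟩, rfl⟩ := hN
      exact hV.image_submatrix i _ ⟨M, ⟨hMV, LinearMap.mem_ker.mp hM⟩, rfl⟩
    rw [LinearMap.finrank_range_of_inj hφ] at hminor
    have hrank := (column.domRestrict V).finrank_range_add_finrank_ker
    have hchoose : (n + 1).choose 2 = n + n.choose 2 := by
      rw [Nat.choose_succ_succ' n 1, Nat.choose_one_right]
    omega

/-- If `V` is a linear subspace of `M_n(K)` with a trivial spectrum,
then `dim V ≤ n(n-1)/2`. -/
theorem dim_le_of_trivialSpectrum (K : Type*) [Field K] (n : ℕ) (hn : 0 < n)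
    (V : Submodule K (Matrix (Fin n) (Fin n) K))
    (hV : TrivialSpectrum (V : Set (Matrix (Fin n) (Fin n) K))) :
    Module.finrank K V ≤ n * (n - 1) / 2 := by
  rw [← Nat.choose_two_right]
  exact TrivialSpectrum.finrank_le_choose V hV
end

section
/- Assume K has at least three elements and let n be a positive integer. A linear subspace V of M_n(K) is an irreducible maximal linear subspace with a trivial spectrum if and only if V = P·Alt_n(K) for some non-isotropic matrix P ∈ GL_n(K). -/
open Matrix

/-- The set of alternate matrices: those `A` with `Xᵀ A X = 0` for all `X`. -/
def altSet (K : Type*) [Field K] (n : ℕ) : Set (Matrix (Fin n) (Fin n) K) :=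
  {A | ∀ X : Fin n → K, X ⬝ᵥ A.mulVec X = 0}

/-- A matrix `P` is non-isotropic if `Xᵀ P X ≠ 0` for every non-zero `X`. -/
def nonIsotropic {K : Type*} [Field K] {n : ℕ} (P : Matrix (Fin n) (Fin n) K) : Prop :=
  ∀ X : Fin n → K, X ≠ 0 → X ⬝ᵥ P.mulVec X ≠ 0

/-- A subspace of `M_n(K)` is irreducible if the only subspaces of `K^n` invariant under
every matrix of it are `⊥` and `⊤`. -/
def IrreducibleMatSpace {K : Type*} [Field K] {n : ℕ}
    (V : Set (Matrix (Fin n) (Fin n) K)) : Prop :=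
  ∀ W : Submodule K (Fin n → K), (∀ M ∈ V, ∀ x ∈ W, M.mulVec x ∈ W) → W = ⊥ ∨ W = ⊤

section TrivialSpectrumSpaces

open Module Submodule

variable {K E : Type*} [Field K] [AddCommGroup E] [Module K E]

/-- No operator of `V` has a non-zero fixed vector. -/
def FixedPointFree (V : Submodule K (End K E)) : Prop :=
  ∀ M ∈ V, ∀ x, M x = x → x = 0

/-- The space `V` has dimension `n (n - 1) / 2`, where `n = dim E`. -/
def HasMaximalDim (V : Submodule K (End K E)) : Prop :=
  2 * finrank K V + finrank K E = finrank K E * finrank K E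

/-- Only the trivial subspaces are invariant under `V`. -/
def ActsIrreducibly (V : Submodule K (End K E)) : Prop :=
  ∀ W : Submodule K E, (∀ M ∈ V, ∀ x ∈ W, M x ∈ W) → W = ⊥ ∨ W = ⊤

/-- The space `V x` of all values at `x` of operators of `V`. -/
def valuesAt (V : Submodule K (End K E)) (x : E) : Submodule K E :=
  V.map (LinearMap.applyₗ x)

/-- The operators of `V` that vanish at `x`. -/
def vanishingAt (V : Submodule K (End K E)) (x : E) : Submodule K (End K E) :=
  V ⊓ LinearMap.ker (LinearMap.applyₗ (R := K) (M := E) (M₂ := E) x)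

/-- The span of the images of the rank one operators of `V`. -/
def rankOneSpan (V : Submodule K (End K E)) : Submodule K E :=
  span K {u | ∃ f : Dual K E, f ≠ 0 ∧ f.smulRight u ∈ V}

/-- The operators induced on `E ⧸ K x` by the operators of `V` that vanish at `x`. -/
def descent (V : Submodule K (End K E)) (x : E) : Submodule K (End K (E ⧸ K ∙ x)) where
  carrier := {N | ∃ M ∈ V, M x = 0 ∧ ∀ y, N ((K ∙ x).mkQ y) = (K ∙ x).mkQ (M y)}
  zero_mem' := ⟨0, V.zero_mem, by simp⟩
  add_mem' := by
    rintro A B ⟨M, hM, hMx, h⟩ ⟨N, hN, hNx, h'⟩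
    exact ⟨M + N, V.add_mem hM hN, by simp [hMx, hNx], fun y => by
      rw [LinearMap.add_apply, h, h', LinearMap.add_apply, map_add]⟩
  smul_mem' := by
    rintro c A ⟨M, hM, hMx, h⟩
    exact ⟨c • M, V.smul_mem c hM, by simp [hMx], fun y => by
      rw [LinearMap.smul_apply, h, LinearMap.smul_apply, map_smul]⟩

variable {V : Submodule K (End K E)}

theorem mem_valuesAt {x w : E} : w ∈ valuesAt V x ↔ ∃ M ∈ V, M x = w := by
  simp [valuesAt]

theorem mem_vanishingAt {x : E} {M : End K E} : M ∈ vanishingAt V x ↔ M ∈ V ∧ M x = 0 := by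
  simp [vanishingAt]

theorem FixedPointFree.notMem_valuesAt (hV : FixedPointFree V) {x : E} (hx : x ≠ 0) :
    x ∉ valuesAt V x := by
  rw [mem_valuesAt]
  rintro ⟨M, hM, h⟩
  exact hx (hV M hM x h)

/-- If every non-zero vector `z` has a coordinate at which `z` is non-zero and `N z` vanishes, then
every non-empty principal submatrix of `N` has a zero row. -/
theorem exists_zero_row {ι : Type*} [Fintype ι] [DecidableEq ι] (N : Matrix ι ι K)
    (h : ∀ z : ι → K, z ≠ 0 → ∃ i, z i ≠ 0 ∧ ∑ j, N i j * z j = 0) (S : Finset ι)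
    (hS : S.Nonempty) : ∃ i ∈ S, ∀ j ∈ S, N i j = 0 := by
  induction S using Finset.strongInduction with
  | H S ih =>
    by_contra! hrow
    have key : ∀ k : S, ∃ i : S, N i k ≠ 0 ∧ ∀ j ∈ S, j ≠ k → N i j = 0 := by
      rintro ⟨k, hk⟩
      by_cases he : (S.erase k).Nonempty
      · obtain ⟨i, hi, hij⟩ := ih _ (Finset.erase_ssubset hk) he
        have hiS := Finset.mem_of_mem_erase hi
        obtain ⟨j, hj, hne⟩ := hrow i hiS
        have hjk : j = k := by
          by_contra hjk
          exact hne (hij j (Finset.mem_erase.2 ⟨hjk, hj⟩))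
        subst hjk
        exact ⟨⟨i, hiS⟩, hne, fun l hl hlj => hij l (Finset.mem_erase.2 ⟨hlj, hl⟩)⟩
      · have hSk : ∀ j ∈ S, j = k := by
          intro j hj
          by_contra hjk
          exact he ⟨j, Finset.mem_erase.2 ⟨hjk, hj⟩⟩
        obtain ⟨j, hj, hne⟩ := hrow k hk
        rw [hSk j hj] at hne
        exact ⟨⟨k, hk⟩, hne, fun j hj hjk => absurd (hSk j hj) hjk⟩
    choose σ hσ hσ' using key
    have hinj : Function.Injective σ := by
      intro k l hkl
      by_contra hne
      refine hσ k ?_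
      rw [hkl]
      exact hσ' l k k.2 fun h => hne (Subtype.ext h)
    have hsurj := Finite.surjective_of_injective hinj
    obtain ⟨s, hs⟩ := hS
    obtain ⟨i, hi, hsum⟩ := h (fun j => if j ∈ S then 1 else 0) (fun h0 => by
      have := congrFun h0 s
      simp [hs] at this)
    have hiS : i ∈ S := by
      by_contra hiS
      simp [hiS] at hi
    obtain ⟨k, hk⟩ := hsurj ⟨i, hiS⟩
    refine hσ k ?_
    rw [hk]
    rw [Finset.sum_eq_single (k : ι)] at hsum
    · simpa using hsum
    · intro j _ hjk
      by_cases hj : j ∈ S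
      · have := hσ' k j hj hjk
        rw [hk] at this
        simp [this]
      · simp [hj]
    · simp

theorem FixedPointFree.rankOneSpan_ne_top [FiniteDimensional K E] [Nontrivial E]
    (hV : FixedPointFree V) : rankOneSpan V ≠ ⊤ := by
  classical
  intro htop
  obtain ⟨b, hbs, hb⟩ : ∃ s ⊆ {u | ∃ f : Dual K E, f ≠ 0 ∧ f.smulRight u ∈ V},
      ∃ b : Basis s K E, ⇑b = Subtype.val := by
    obtain ⟨s, hs, hspan, hli⟩ := exists_linearIndependent K
      {u | ∃ f : Dual K E, f ≠ 0 ∧ f.smulRight u ∈ V}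
    refine ⟨s, hs, Basis.mk hli ?_, Basis.coe_mk _ _⟩
    rw [Subtype.range_coe, hspan]
    exact htop.ge
  obtain ⟨e, he⟩ := hb
  have : Fintype b := FiniteDimensional.fintypeBasisIndex e
  choose f hf0 hfV using fun i : b => hbs i.2
  have : Nonempty b := e.index_nonempty
  obtain ⟨i, -, hi⟩ := exists_zero_row (fun i j => f i (e j)) (fun z hz => by
    by_contra! hcon
    set w := ∑ j, z j • e j with hw
    have hfw : ∀ i, f i w = ∑ j, f i (e j) * z j := fun i => by
      rw [hw, map_sum]
      exact Finset.sum_congr rfl fun j _ => by rw [map_smul, smul_eq_mul, mul_comm]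
    have hw0 : w = 0 := by
      refine hV (∑ i, (z i / f i w) • (f i).smulRight (i : E))
        (V.sum_mem fun i _ => V.smul_mem _ (hfV i)) w ?_
      rw [LinearMap.sum_apply]
      conv_rhs => rw [hw]
      refine Finset.sum_congr rfl fun i _ => ?_
      by_cases hi : z i = 0
      · simp [hi]
      · have := hcon i hi
        rw [← hfw] at this
        simp [smul_smul, div_mul_cancel₀ _ this, he]
    refine hz (funext fun i => ?_)
    have := Fintype.linearIndependent_iff.1 e.linearIndependent z hw0 i
    simpa using this) Finset.univ Finset.univ_nonempty
  exact hf0 i (e.ext fun j => by simpa using hi j (Finset.mem_univ j))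

theorem FixedPointFree.on_descent (hV : FixedPointFree V) {x : E} :
    FixedPointFree (descent V x) := by
  rintro N ⟨M, hM, hMx, h⟩ z hz
  obtain ⟨y, rfl⟩ := (K ∙ x).mkQ_surjective z
  rw [h, ← sub_eq_zero, ← map_sub, mkQ_apply, Quotient.mk_eq_zero, mem_span_singleton] at hz
  obtain ⟨c, hc⟩ := hz
  have hfix : M (y + c • x) = y + c • x := by
    rw [map_add, map_smul, hMx, smul_zero, add_zero, hc]
    abel
  have := hV M hM _ hfix
  rw [mkQ_apply, Quotient.mk_eq_zero, mem_span_singleton]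
  exact ⟨-c, by rw [neg_smul]; exact neg_eq_of_add_eq_zero_left this⟩

theorem ne_zero_of_notMem_rankOneSpan {x : E} (hx : x ∉ rankOneSpan V) : x ≠ 0 := by
  rintro rfl
  exact hx (zero_mem _)

theorem finrank_quotient_singleton [FiniteDimensional K E] {x : E} (hx : x ≠ 0) :
    finrank K (E ⧸ K ∙ x) + 1 = finrank K E := by
  rw [← finrank_span_singleton (K := K) hx, finrank_quotient_add_finrank]

theorem mem_rankOneSpan {u : E} {f : Dual K E} (hf : f ≠ 0) (h : f.smulRight u ∈ V) :
    u ∈ rankOneSpan V :=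
  subset_span (show u ∈ {u | ∃ f : Dual K E, f ≠ 0 ∧ f.smulRight u ∈ V} from ⟨f, hf, h⟩)

theorem FixedPointFree.mem_of_sub_mem (hV : FixedPointFree V) {S R : Submodule K E}
    (hSR : ∀ r ∈ S, ∀ g : Dual K E, (∀ w ∈ R, g w = 0) → g.smulRight r ∈ V) {M : End K E}
    (hM : M ∈ V) {z : E} (hz : M z - z ∈ S) : z ∈ R := by
  by_contra hzR
  obtain ⟨g, hgz, hg⟩ := exists_le_ker_of_notMem hzR
  have := hV (M - (g z)⁻¹ • g.smulRight (M z - z))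
    (V.sub_mem hM (V.smul_mem _ (hSR _ hz g fun w hw => hg hw))) z (by
      simp [smul_smul, inv_mul_cancel₀ hgz])
  exact hzR (this ▸ zero_mem R)

theorem FixedPointFree.valuesAt_ne_top (hV : FixedPointFree V) {z : E} (hz : z ≠ 0) :
    valuesAt V z ≠ ⊤ := fun h => hV.notMem_valuesAt hz (h ▸ mem_top)

theorem linearIndependent_pair_of_mkQ_ne_zero {x y : E} (hx : x ≠ 0)
    (hy : (K ∙ x).mkQ y ≠ 0) : LinearIndependent K ![x, y] := by
  rw [LinearIndependent.pair_iff' hx]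
  rintro a rfl
  exact hy (by simp)

theorem exists_combination_eq_zero_of_finrank_le_two {F : Submodule K E} [FiniteDimensional K F]
    (hF : finrank K F ≤ 2) {u v w : E} (hu : u ∈ F) (hv : v ∈ F) (hw : w ∈ F) :
    ∃ a b c : K, a • u + b • v + c • w = 0 ∧ (a = 0 → b = 0 → c ≠ 0) := by
  have hdep : ¬ LinearIndependent K (![⟨u, hu⟩, ⟨v, hv⟩, ⟨w, hw⟩] : Fin 3 → F) := by
    intro hli
    have := hli.fintype_card_le_finrank
    rw [Fintype.card_fin] at this
    omega
  obtain ⟨c, hc, i, hi⟩ := Fintype.not_linearIndependent_iff.1 hdep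
  refine ⟨c 0, c 1, c 2, ?_, fun h₀ h₁ h₂ => hi ?_⟩
  · simpa [Fin.sum_univ_three] using congrArg Subtype.val hc
  · fin_cases i
    exacts [h₀, h₁, h₂]

theorem apply_eq_zero_of_ker_eq {x : E} {g : Dual K E} (h : LinearMap.ker g = valuesAt V x)
    {M : End K E} (hM : M ∈ V) : g (M x) = 0 :=
  LinearMap.mem_ker.1 (h ▸ mem_valuesAt.2 ⟨M, hM, rfl⟩)

variable [FiniteDimensional K E]

theorem finrank_valuesAt_add_finrank_vanishingAt (V : Submodule K (End K E)) (x : E) :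
    finrank K (valuesAt V x) + finrank K (vanishingAt V x) = finrank K V := by
  have h := LinearMap.finrank_range_add_finrank_ker
    ((LinearMap.applyₗ (R := K) (M := E) (M₂ := E) x).domRestrict V)
  rw [LinearMap.range_domRestrict] at h
  rw [← h, valuesAt, vanishingAt, LinearMap.ker_domRestrict, ← Submodule.map_comap_subtype]
  congr 1
  exact (LinearEquiv.finrank_eq (Submodule.equivMapOfInjective _ V.injective_subtype _)).symm

theorem FixedPointFree.finrank_valuesAt_lt (hV : FixedPointFree V) {x : E} (hx : x ≠ 0) :
    finrank K (valuesAt V x) < finrank K E :=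
  finrank_lt (fun h => hV.notMem_valuesAt hx (h ▸ mem_top))

theorem finrank_vanishingAt_le {x : E} (hx : x ∉ rankOneSpan V) :
    finrank K (vanishingAt V x) ≤ finrank K (descent V x) := by
  have hle : ∀ M ∈ vanishingAt V x, K ∙ x ≤ (K ∙ x).comap M := fun M hM => by
    rw [span_singleton_le_iff_mem, mem_comap, (mem_vanishingAt.1 hM).2]
    exact zero_mem _
  let Φ : vanishingAt V x →ₗ[K] descent V x :=
    { toFun := fun M => ⟨(K ∙ x).mapQ (K ∙ x) M.1 (hle _ M.2), M.1, (mem_vanishingAt.1 M.2).1,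
        (mem_vanishingAt.1 M.2).2, fun y => rfl⟩
      map_add' := fun M N => by
        ext y
        rfl
      map_smul' := fun c M => by
        ext y
        rfl }
  refine LinearMap.finrank_le_finrank_of_injective (f := Φ) ?_
  rw [injective_iff_map_eq_zero]
  rintro ⟨M, hM⟩ h
  have hx0 := ne_zero_of_notMem_rankOneSpan hx
  have hy : ∀ y, ∃ c : K, c • x = M y := fun y => by
    have : (K ∙ x).mkQ (M y) = 0 := by
      have := LinearMap.congr_fun (congrArg Subtype.val h) ((K ∙ x).mkQ y)
      exact this
    rwa [mkQ_apply, Quotient.mk_eq_zero, mem_span_singleton] at this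
  choose c hc using hy
  let f : Dual K E :=
    { toFun := c
      map_add' := fun y z => by
        refine smul_left_injective K hx0 ?_
        simp only [add_smul, hc, map_add]
      map_smul' := fun a y => by
        refine smul_left_injective K hx0 ?_
        simp only [smul_assoc, hc, map_smul, RingHom.id_apply] }
  have hMf : f.smulRight x = M := LinearMap.ext hc
  by_cases hf : f = 0
  · ext y
    rw [hf] at hMf
    simp [← hMf]
  · exact absurd (subset_span (show x ∈ {u | ∃ f : Dual K E, f ≠ 0 ∧ f.smulRight u ∈ V} from
      ⟨f, hf, hMf ▸ (mem_vanishingAt.1 hM).1⟩)) hx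

theorem FixedPointFree.finrank_le (hV : FixedPointFree V) :
    2 * finrank K V + finrank K E ≤ finrank K E * finrank K E := by
  induction hn : finrank K E generalizing E with
  | zero =>
    have := finrank_zero_iff.1 hn
    have : Subsingleton (End K E) := ⟨fun f g => LinearMap.ext fun x => Subsingleton.elim _ _⟩
    simp [finrank_zero_of_subsingleton]
  | succ n ih =>
    have : Nontrivial E := nontrivial_of_finrank_pos (R := K) (by omega)
    obtain ⟨x, -, hx⟩ := SetLike.exists_of_lt (lt_top_iff_ne_top.2 hV.rankOneSpan_ne_top)
    have hx0 := ne_zero_of_notMem_rankOneSpan hx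
    have h1 := finrank_quotient_singleton (K := K) hx0
    have h2 := ih (hV.on_descent (x := x)) (by omega)
    have h3 := finrank_vanishingAt_le hx
    have h4 := hV.finrank_valuesAt_lt hx0
    have h5 := finrank_valuesAt_add_finrank_vanishingAt V x
    rw [hn] at h4
    nlinarith

theorem HasMaximalDim.finrank_valuesAt (hV : FixedPointFree V) (hmax : HasMaximalDim V) {x : E}
    (hx : x ∉ rankOneSpan V) :
    finrank K (valuesAt V x) + 1 = finrank K E := by
  have hx0 := ne_zero_of_notMem_rankOneSpan hx
  have h1 := finrank_quotient_singleton (K := K) hx0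
  have h2 := (hV.on_descent (x := x)).finrank_le
  have h3 := finrank_vanishingAt_le hx
  have h4 := hV.finrank_valuesAt_lt hx0
  have h5 := finrank_valuesAt_add_finrank_vanishingAt V x
  rw [HasMaximalDim, ← h1] at hmax
  rw [← h1] at h4 ⊢
  nlinarith

theorem HasMaximalDim.on_descent (hV : FixedPointFree V) (hmax : HasMaximalDim V) {x : E}
    (hx : x ∉ rankOneSpan V) : HasMaximalDim (descent V x) := by
  have hx0 := ne_zero_of_notMem_rankOneSpan hx
  have h1 := finrank_quotient_singleton (K := K) hx0
  have h2 := (hV.on_descent (x := x)).finrank_le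
  have h3 := finrank_vanishingAt_le hx
  have h4 := hV.finrank_valuesAt_lt hx0
  have h5 := finrank_valuesAt_add_finrank_vanishingAt V x
  rw [HasMaximalDim, ← h1] at hmax
  rw [← h1] at h4
  rw [HasMaximalDim]
  nlinarith

theorem FixedPointFree.apply_mem_of_sub_mem (hV : FixedPointFree V) {S : Submodule K E}
    (hS : ∀ M ∈ V, ∀ z, M z - z ∈ S → z ∈ S) {M : End K E} (hM : M ∈ V) {x : E} (hx : x ∈ S) :
    M x ∈ S := by
  have hinj : Function.Injective (M - LinearMap.id : End K E) := by
    rw [injective_iff_map_eq_zero]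
    intro z hz
    exact hV M hM z (sub_eq_zero.1 (by simpa using hz))
  have hsurj : Function.Surjective (M - LinearMap.id : End K E) :=
    LinearMap.injective_iff_surjective.1 hinj
  have hle : S ≤ S.map (M - LinearMap.id : End K E) := by
    intro s hs
    obtain ⟨z, hz⟩ := hsurj s
    exact ⟨z, hS M hM z (by simpa [← hz] using hs), hz⟩
  have heq := eq_of_le_of_finrank_le hle (finrank_map_le _ _)
  have : (M - LinearMap.id : End K E) x ∈ S := by
    rw [heq]
    exact mem_map_of_mem hx
  simpa using S.add_mem this hx

theorem HasMaximalDim.smulRight_mem (hV : FixedPointFree V) (hmax : HasMaximalDim V)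
    {W : Submodule K E} (hW : ∀ M ∈ V, ∀ x ∈ W, M x ∈ W) {r : E} (hr : r ∈ W) {g : Dual K E}
    (hg : ∀ w ∈ W, g w = 0) : g.smulRight r ∈ V := by
  let Φ₁ : V →ₗ[K] End K W :=
    { toFun := fun M => M.1.restrict (hW M.1 M.2)
      map_add' := fun M N => rfl
      map_smul' := fun c M => rfl }
  let Φ₂ : V →ₗ[K] End K (E ⧸ W) :=
    { toFun := fun M => W.mapQ W M.1 (hW M.1 M.2)
      map_add' := fun M N => by
        ext y
        rfl
      map_smul' := fun c M => by
        ext y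
        rfl }
  let Ψ : ((E ⧸ W) →ₗ[K] W) →ₗ[K] End K E :=
    { toFun := fun ψ => W.subtype ∘ₗ ψ ∘ₗ W.mkQ
      map_add' := fun M N => rfl
      map_smul' := fun c M => rfl }
  have h₁ : FixedPointFree (LinearMap.range Φ₁) := by
    rintro _ ⟨M, rfl⟩ x hx
    exact Subtype.ext (hV M.1 M.2 x (congrArg Subtype.val hx))
  have h₂ : FixedPointFree (LinearMap.range Φ₂) := by
    rintro _ ⟨M, rfl⟩ z hz
    obtain ⟨y, rfl⟩ := W.mkQ_surjective z
    have hy : M.1 y - y ∈ W := (Submodule.Quotient.eq W).1 hz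
    have hinj : Function.Injective (M.1 - LinearMap.id : End K E) := by
      rw [injective_iff_map_eq_zero]
      intro z hz
      exact hV M M.2 z (sub_eq_zero.1 (by simpa using hz))
    have hle : W.map (M.1 - LinearMap.id : End K E) ≤ W := by
      rintro _ ⟨w, hw, rfl⟩
      exact W.sub_mem (hW M.1 M.2 w hw) hw
    have heq := eq_of_le_of_finrank_le hle
      (LinearEquiv.finrank_eq (Submodule.equivMapOfInjective _ hinj W)).le
    have hy' : (M.1 - LinearMap.id : End K E) y ∈ W.map (M.1 - LinearMap.id : End K E) := by
      rw [heq]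
      exact hy
    obtain ⟨w, hw, hwy⟩ := hy'
    rw [mkQ_apply, Quotient.mk_eq_zero, ← hinj hwy]
    exact hw
  have d₁ := h₁.finrank_le
  have d₂ := h₂.finrank_le
  have e₁ := Φ₁.finrank_range_add_finrank_ker
  have e₂ := Φ₂.finrank_range_add_finrank_ker
  have e₃ := finrank_sup_add_finrank_inf_eq (LinearMap.ker Φ₁) (LinearMap.ker Φ₂)
  have e₄ := finrank_le (LinearMap.ker Φ₁ ⊔ LinearMap.ker Φ₂)
  have e₅ := W.finrank_quotient_add_finrank
  have e₆ : finrank K (LinearMap.range Ψ) ≤ finrank K (E ⧸ W) * finrank K W := by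
    rw [← finrank_linearMap]
    exact Ψ.finrank_range_le
  have hle : (LinearMap.ker Φ₁ ⊓ LinearMap.ker Φ₂).map V.subtype ≤ LinearMap.range Ψ := by
    rintro _ ⟨M, ⟨hM₁, hM₂⟩, rfl⟩
    have hmem : ∀ y, M.1 y ∈ W := fun y => by
      have : W.mkQ (M.1 y) = 0 := LinearMap.congr_fun (LinearMap.mem_ker.1 hM₂) (W.mkQ y)
      rwa [mkQ_apply, Quotient.mk_eq_zero] at this
    refine ⟨W.liftQ (M.1.codRestrict W hmem) fun w hw => ?_, ?_⟩
    · have := LinearMap.congr_fun (LinearMap.mem_ker.1 hM₁) ⟨w, hw⟩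
      exact Subtype.ext (congrArg Subtype.val this)
    · ext y
      rfl
  have e₇ : finrank K ((LinearMap.ker Φ₁ ⊓ LinearMap.ker Φ₂).map V.subtype) =
      finrank K ↥(LinearMap.ker Φ₁ ⊓ LinearMap.ker Φ₂) :=
    (LinearEquiv.finrank_eq (Submodule.equivMapOfInjective _ V.injective_subtype _)).symm
  have heq := eq_of_le_of_finrank_le hle (by
    rw [HasMaximalDim, ← e₅] at hmax
    nlinarith)
  have : g.smulRight r ∈ LinearMap.range Ψ := by
    refine ⟨W.liftQ (g.smulRight ⟨r, hr⟩) fun w hw => ?_, ?_⟩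
    · simp [hg w hw]
    · ext y
      rfl
  rw [← heq] at this
  obtain ⟨M, -, hM⟩ := this
  rw [← hM]
  exact M.2

/-- The key step, where a scalar different from `0` and `1` is needed. -/
theorem exists_dual_vanishing {t : K} (ht₀ : t ≠ 0) (ht₁ : t ≠ 1)
    (hV : ∀ z ≠ 0, valuesAt V z ≠ ⊤) {x y : E} (hxy : LinearIndependent K ![x, y])
    (hF : finrank K E ≤ finrank K (valuesAt (vanishingAt V x) y) + 2) :
    ∃ φ : Dual K E, φ ≠ 0 ∧ ∀ M ∈ V, φ (M x) = 0 ∧ (M x = 0 → φ (M y) = 0) := by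
  have hform : ∀ z ≠ 0, ∃ α : Dual K E, α ≠ 0 ∧ ∀ M ∈ V, α (M z) = 0 := by
    intro z hz
    obtain ⟨α, hα, h⟩ := exists_le_ker_of_lt_top _ (lt_top_iff_ne_top.2 (hV z hz))
    exact ⟨α, hα, fun M hM => h (mem_valuesAt.2 ⟨M, hM, rfl⟩)⟩
  rw [LinearIndependent.pair_iff] at hxy
  have hne : ∀ s : K, x + s • y ≠ 0 := fun s hs => one_ne_zero (hxy 1 s (by simpa using hs)).1
  obtain ⟨α, hα, hαV⟩ := hform y fun h => one_ne_zero (hxy 0 1 (by simp [h])).2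
  obtain ⟨β, hβ, hβV⟩ := hform _ (hne 1)
  obtain ⟨γ, hγ, hγV⟩ := hform _ (hne t)
  simp only [map_add, map_smul, smul_eq_mul, one_mul] at hβV hγV
  have hmem : ∀ δ : Dual K E, (∀ M ∈ V, M x = 0 → δ (M y) = 0) →
      δ ∈ (valuesAt (vanishingAt V x) y).dualAnnihilator := by
    intro δ hδ
    rw [mem_dualAnnihilator]
    intro w hw
    obtain ⟨M, hM, rfl⟩ := mem_valuesAt.1 hw
    exact hδ M (mem_vanishingAt.1 hM).1 (mem_vanishingAt.1 hM).2
  have hα' : ∀ M ∈ V, M x = 0 → α (M y) = 0 := fun M hM _ => hαV M hM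
  have hβ' : ∀ M ∈ V, M x = 0 → β (M y) = 0 := fun M hM hMx => by
    simpa [hMx] using hβV M hM
  have hγ' : ∀ M ∈ V, M x = 0 → γ (M y) = 0 := fun M hM hMx => by
    simpa [hMx, ht₀] using hγV M hM
  obtain ⟨p, q, r, hc, hc0⟩ := exists_combination_eq_zero_of_finrank_le_two (by
    have := Subspace.finrank_add_finrank_dualAnnihilator_eq (valuesAt (vanishingAt V x) y)
    omega) (hmem α hα') (hmem β hβ') (hmem γ hγ')
  have hcM : ∀ w, p * α w + q * β w + r * γ w = 0 := fun w => by
    simpa using LinearMap.congr_fun hc w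
  by_cases hφ : q • β + (r / t) • γ = 0
  · have hφw : ∀ w, q * β w + r / t * γ w = 0 := fun w => by
      simpa using LinearMap.congr_fun hφ w
    have h1 : q ≠ 0 := by
      intro h1
      have h2 : r = 0 := by
        simpa [h1, hγ, ht₀] using hφ
      have h0 : p = 0 := by
        simpa [h1, h2, hα] using hc
      exact hc0 h0 h1 h2
    have h2 : r ≠ 0 := by
      intro h2
      simp [h2, h1, hβ] at hφ
    refine ⟨γ, hγ, fun M hM => ⟨?_, hγ' M hM⟩⟩
    have e₁ := hφw (M x)
    have e₂ := hφw (M y)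
    have e₃ := hβV M hM
    have e₄ := hγV M hM
    have e₅ : r * (γ (M x) + γ (M y)) = 0 := by
      field_simp at e₁ e₂
      linear_combination e₁ + e₂ - t * q * e₃
    have e₆ := (mul_eq_zero.1 e₅).resolve_left h2
    have e₇ : (t - 1) * γ (M x) = 0 := by linear_combination t * e₆ - e₄
    exact (mul_eq_zero.1 e₇).resolve_left (sub_ne_zero.2 ht₁)
  · refine ⟨_, hφ, fun M hM => ⟨?_, fun hMx => ?_⟩⟩
    · simp only [LinearMap.add_apply, LinearMap.smul_apply, smul_eq_mul]
      have e₁ := hcM (M y)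
      rw [hαV M hM] at e₁
      have e₃ := hβV M hM
      have e₄ := hγV M hM
      field_simp
      linear_combination (-t) * e₁ + t * q * e₃ + r * e₄
    · simp [hβ' M hM hMx, hγ' M hM hMx]

theorem finrank_le_finrank_valuesAt_vanishingAt (hV : FixedPointFree V) (hmax : HasMaximalDim V)
    {x y : E} (hx : x ∉ rankOneSpan V) (hy : (K ∙ x).mkQ y ∉ rankOneSpan (descent V x)) :
    finrank K E ≤ finrank K (valuesAt (vanishingAt V x) y) + 2 := by
  have h₁ := (hmax.on_descent hV hx).finrank_valuesAt hV.on_descent hy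
  have h₂ := finrank_quotient_singleton (K := K) (ne_zero_of_notMem_rankOneSpan hx)
  have h₃ : valuesAt (descent V x) ((K ∙ x).mkQ y) ≤
      (valuesAt (vanishingAt V x) y).map (K ∙ x).mkQ := by
    intro w hw
    obtain ⟨N, ⟨M, hM, hMx, h⟩, rfl⟩ := mem_valuesAt.1 hw
    rw [h]
    exact mem_map_of_mem (mem_valuesAt.2 ⟨M, mem_vanishingAt.2 ⟨hM, hMx⟩, rfl⟩)
  have h₄ := (finrank_mono h₃).trans (finrank_map_le _ _)
  omega

theorem HasMaximalDim.apply_mem_valuesAt {t : K} (ht₀ : t ≠ 0) (ht₁ : t ≠ 1)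
    (hV : FixedPointFree V) (hmax : HasMaximalDim V) {x : E} (hx : x ∉ rankOneSpan V)
    {M : End K E} (hM : M ∈ V) (hMx : M x = 0) (y : E) : M y ∈ valuesAt V x := by
  have hx0 := ne_zero_of_notMem_rankOneSpan hx
  have key : ∀ y, (K ∙ x).mkQ y ∉ rankOneSpan (descent V x) → M y ∈ valuesAt V x := by
    intro y hy
    have hli := linearIndependent_pair_of_mkQ_ne_zero hx0 (ne_zero_of_notMem_rankOneSpan hy)
    obtain ⟨φ, hφ, h⟩ := exists_dual_vanishing ht₀ ht₁ (fun z => hV.valuesAt_ne_top) hli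
      (finrank_le_finrank_valuesAt_vanishingAt hV hmax hx hy)
    have hle : valuesAt V x ≤ LinearMap.ker φ := by
      intro w hw
      obtain ⟨N, hN, rfl⟩ := mem_valuesAt.1 hw
      exact (h N hN).1
    have heq := eq_of_le_of_finrank_le hle (by
      have h₁ := hmax.finrank_valuesAt hV hx
      have h₂ := finrank_lt (s := LinearMap.ker φ) (fun h => hφ (LinearMap.ker_eq_top.1 h))
      omega)
    rw [heq]
    exact (h M hM).2 hMx
  by_cases hy : (K ∙ x).mkQ y ∈ rankOneSpan (descent V x)
  · cases subsingleton_or_nontrivial (E ⧸ K ∙ x) with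
    | inl hs =>
      have : y ∈ K ∙ x := by
        rw [← Quotient.mk_eq_zero]
        exact Subsingleton.elim _ _
      obtain ⟨c, rfl⟩ := mem_span_singleton.1 this
      simp [hMx]
    | inr hn =>
      obtain ⟨z, -, hz⟩ := SetLike.exists_of_lt
        (lt_top_iff_ne_top.2 (hV.on_descent (x := x)).rankOneSpan_ne_top)
      obtain ⟨z, rfl⟩ := (K ∙ x).mkQ_surjective z
      have h₁ := key z hz
      have h₂ := key (y + z) (by
        rw [map_add]
        intro h
        exact hz (by simpa using sub_mem h hy))
      rw [map_add] at h₂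
      simpa using sub_mem h₂ h₁
  · exact key y hy

theorem HasMaximalDim.mem_valuesAt_of_smulRight_mem {t : K} (ht₀ : t ≠ 0) (ht₁ : t ≠ 1)
    (hV : FixedPointFree V) (hmax : HasMaximalDim V) {u z : E} {f : Dual K E} (hf : f ≠ 0)
    (hu : f.smulRight u ∈ V) (hz : z ∉ rankOneSpan V) : u ∈ valuesAt V z := by
  obtain ⟨y, hy⟩ : ∃ y, f y ≠ 0 := by
    by_contra! h
    exact hf (LinearMap.ext h)
  by_cases hfz : f z = 0
  · have := hmax.apply_mem_valuesAt ht₀ ht₁ hV hz hu (by simp [hfz]) y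
    rwa [LinearMap.smulRight_apply, smul_mem_iff _ hy] at this
  · have : f z • u ∈ valuesAt V z := mem_valuesAt.2 ⟨_, hu, rfl⟩
    rwa [smul_mem_iff _ hfz] at this

theorem ActsIrreducibly.on_descent {t : K} (ht₀ : t ≠ 0) (ht₁ : t ≠ 1)
    (hirr : ActsIrreducibly V) (hV : FixedPointFree V) (hmax : HasMaximalDim V) {x : E}
    (hx : x ∉ rankOneSpan V) : ActsIrreducibly (descent V x) := by
  intro Q hQ
  by_contra! hQ'
  have hx0 := ne_zero_of_notMem_rankOneSpan hx
  have hxV := hV.notMem_valuesAt hx0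
  set R := Q.comap (K ∙ x).mkQ with hR
  have hxR : x ∈ R := by
    rw [hR, mem_comap, mkQ_apply, (Quotient.mk_eq_zero _).2 (mem_span_singleton_self x)]
    exact zero_mem _
  obtain ⟨g₀, hg₀, hg₀R⟩ : ∃ g : Dual K E, g ≠ 0 ∧ ∀ w ∈ R, g w = 0 := by
    obtain ⟨g, hg, h⟩ := exists_le_ker_of_lt_top R (lt_top_iff_ne_top.2 fun h => hQ'.2 (by
      rw [eq_top_iff]
      intro q _
      obtain ⟨y, rfl⟩ := (K ∙ x).mkQ_surjective q
      have : y ∈ R := h ▸ mem_top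
      exact this))
    exact ⟨g, hg, fun w hw => h hw⟩
  set S := R ⊓ valuesAt V x with hS
  have hSR : ∀ r ∈ S, ∀ g : Dual K E, (∀ w ∈ R, g w = 0) → g.smulRight r ∈ V := by
    rintro r ⟨hrR, hrV⟩ g hg
    have hgx : K ∙ x ≤ LinearMap.ker g := by
      rw [span_singleton_le_iff_mem]
      exact hg x hxR
    obtain ⟨M, hM, hMx, h⟩ := (hmax.on_descent hV hx).smulRight_mem hV.on_descent hQ
      (r := (K ∙ x).mkQ r) hrR (g := (K ∙ x).liftQ g hgx) (by
        intro q hq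
        obtain ⟨y, rfl⟩ := (K ∙ x).mkQ_surjective q
        exact hg y hq)
    have hMg : M = g.smulRight r := by
      ext y
      have hy : M y - g y • r ∈ K ∙ x := (Submodule.Quotient.eq _).1 (h y).symm
      obtain ⟨c, hc⟩ := mem_span_singleton.1 hy
      have hc' : c • x ∈ valuesAt V x := by
        rw [hc]
        exact sub_mem (hmax.apply_mem_valuesAt ht₀ ht₁ hV hx hM hMx y) (smul_mem _ _ hrV)
      have hc0 : c = 0 := by
        by_contra hc0
        exact hxV ((smul_mem_iff _ hc0).1 hc')
      rw [hc0, zero_smul] at hc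
      exact sub_eq_zero.1 hc.symm
    exact hMg ▸ hM
  have hgood : ∀ z, z ∉ rankOneSpan V → S ≤ valuesAt V z := fun z hz r hr =>
    hmax.mem_valuesAt_of_smulRight_mem ht₀ ht₁ hV hg₀ (hSR r hr g₀ hg₀R) hz
  have hSC : S ≤ rankOneSpan V := fun r hr => mem_rankOneSpan hg₀ (hSR r hr g₀ hg₀R)
  have hdecomp : ∀ z ∈ R, ∃ a : K, ∃ v ∈ S, a • x + v = z := by
    intro z hz
    have hsup : valuesAt V x ⊔ K ∙ x = ⊤ := by
      have h₁ := hmax.finrank_valuesAt hV hx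
      have h₂ : valuesAt V x < valuesAt V x ⊔ K ∙ x := by
        refine lt_of_le_of_ne le_sup_left fun h => hxV ?_
        rw [h]
        exact mem_sup_right (mem_span_singleton_self x)
      have h₃ := finrank_lt_finrank_of_lt h₂
      refine eq_top_of_finrank_eq (le_antisymm (finrank_le _) (by omega))
    obtain ⟨v, hv, w, hw, hvw⟩ := mem_sup.1 (hsup ▸ mem_top : z ∈ valuesAt V x ⊔ K ∙ x)
    obtain ⟨a, rfl⟩ := mem_span_singleton.1 hw
    refine ⟨a, v, ⟨?_, hv⟩, by rw [add_comm, hvw]⟩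
    rw [eq_sub_of_add_eq hvw]
    exact sub_mem hz (smul_mem _ _ hxR)
  have hinv : ∀ M ∈ V, ∀ z ∈ S, M z ∈ S := by
    intro M hM z hz
    refine hV.apply_mem_of_sub_mem (fun M hM z hz => ?_) hM hz
    have hzR := hV.mem_of_sub_mem hSR hM hz
    obtain ⟨a, v, hv, rfl⟩ := hdecomp z hzR
    by_cases ha : a = 0
    · simpa [ha] using hv
    · have hzC : a • x + v ∉ rankOneSpan V := by
        intro h
        have := sub_mem h (hSC hv)
        rw [add_sub_cancel_right, smul_mem_iff _ ha] at this
        exact hx this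
      have hmem := sub_mem (mem_valuesAt.2 ⟨M, hM, rfl⟩) (hgood _ hzC hz)
      rw [sub_sub_cancel] at hmem
      exact absurd hmem (hV.notMem_valuesAt (ne_zero_of_notMem_rankOneSpan hzC))
  rcases hirr S hinv with h | h
  · refine hQ'.1 (eq_bot_iff.2 fun q hq => ?_)
    obtain ⟨y, rfl⟩ := (K ∙ x).mkQ_surjective q
    obtain ⟨a, v, hv, rfl⟩ := hdecomp y hq
    rw [h, mem_bot] at hv
    subst hv
    simp
  · exact hxV (h ▸ mem_top : x ∈ S).2

/-- A maximal irreducible space contains no operator of rank one. -/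
theorem ActsIrreducibly.eq_zero_of_smulRight_mem {t : K} (ht₀ : t ≠ 0) (ht₁ : t ≠ 1)
    (hirr : ActsIrreducibly V) (hV : FixedPointFree V) (hmax : HasMaximalDim V) {u : E}
    {f : Dual K E} (hf : f ≠ 0) (hu : f.smulRight u ∈ V) : u = 0 := by
  induction hn : finrank K E generalizing E with
  | zero =>
    have := finrank_zero_iff.1 hn
    exact Subsingleton.elim _ _
  | succ n ih =>
    have : Nontrivial E := nontrivial_of_finrank_pos (R := K) (by omega)
    by_contra hu0
    have key : ∀ v, ∀ g : Dual K E, g ≠ 0 → g.smulRight v ∈ V → v ≠ 0 →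
        ∀ x, g x = 0 → x ∈ rankOneSpan V := by
      intro v g hg hv hv0 x hgx
      by_contra hx
      have hx0 := ne_zero_of_notMem_rankOneSpan hx
      have hgx' : K ∙ x ≤ LinearMap.ker g := by
        rw [span_singleton_le_iff_mem]
        exact hgx
      have h₁ := finrank_quotient_singleton (K := K) hx0
      have h₂ := ih (hirr.on_descent ht₀ ht₁ hV hmax hx) hV.on_descent (hmax.on_descent hV hx)
        (u := (K ∙ x).mkQ v) (f := (K ∙ x).liftQ g hgx') (fun h => hg (by
          ext y
          exact LinearMap.congr_fun h ((K ∙ x).mkQ y)))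
        ⟨_, hv, by simp [hgx], fun y => by
          rw [LinearMap.smulRight_apply, LinearMap.smulRight_apply, map_smul]
          rfl⟩ (by omega)
      rw [mkQ_apply, Quotient.mk_eq_zero, mem_span_singleton] at h₂
      obtain ⟨a, rfl⟩ := h₂
      have ha : a ≠ 0 := by
        rintro rfl
        simp at hv0
      exact hx ((smul_mem_iff _ ha).1 (mem_rankOneSpan hg hv))
    have hC := hV.rankOneSpan_ne_top
    have hker : ∀ v, ∀ g : Dual K E, g ≠ 0 → g.smulRight v ∈ V → v ≠ 0 →
        LinearMap.ker g = rankOneSpan V := by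
      intro v g hg hv hv0
      refine eq_of_le_of_finrank_le (key v g hg hv hv0) ?_
      have h₁ := finrank_lt hC
      have h₂ := g.finrank_range_add_finrank_ker
      have h₃ := finrank_le (LinearMap.range g)
      rw [finrank_self] at h₃
      omega
    have hmem : ∀ r ∈ rankOneSpan V, ∀ g : Dual K E, (∀ w ∈ rankOneSpan V, g w = 0) →
        g.smulRight r ∈ V := by
      intro r hr g hg
      induction hr using span_induction with
      | mem v hv =>
        obtain ⟨f', hf', hv⟩ := hv
        by_cases hv0 : v = 0
        · simp [hv0]
        · have hle : LinearMap.ker f' ≤ LinearMap.ker g := fun w hw =>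
            hg w (hker v f' hf' hv hv0 ▸ hw)
          obtain ⟨c, rfl⟩ : ∃ c : K, c • f' = g := by
            rw [← mem_span_singleton]
            have := mem_span_of_iInf_ker_le_ker (L := fun _ : Unit => f') (K := g) (by simpa)
            simpa using this
          have : (c • f').smulRight v = c • f'.smulRight v := by
            ext y
            simp [mul_smul]
          rw [this]
          exact V.smul_mem c hv
      | zero => simp
      | add v w _ _ h₁ h₂ =>
        have : g.smulRight (v + w) = g.smulRight v + g.smulRight w := by
          ext y
          simp
        rw [this]
        exact V.add_mem h₁ h₂
      | smul c v _ h =>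
        have : g.smulRight (c • v) = c • g.smulRight v := by
          ext y
          exact smul_comm (g y) c v
        rw [this]
        exact V.smul_mem c h
    rcases hirr (rankOneSpan V) fun M hM x hx => hV.apply_mem_of_sub_mem
      (fun M hM z hz => hV.mem_of_sub_mem hmem hM hz) hM hx with h | h
    · exact hu0 ((mem_bot K).1 (h ▸ mem_rankOneSpan hf hu))
    · exact hC h

theorem ActsIrreducibly.rankOneSpan_eq_bot {t : K} (ht₀ : t ≠ 0) (ht₁ : t ≠ 1)
    (hirr : ActsIrreducibly V) (hV : FixedPointFree V) (hmax : HasMaximalDim V) :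
    rankOneSpan V = ⊥ := by
  rw [rankOneSpan, span_eq_bot]
  rintro u ⟨f, hf, hu⟩
  exact hirr.eq_zero_of_smulRight_mem ht₀ ht₁ hV hmax hf hu

theorem ker_eq_valuesAt {x : E} (hx : finrank K (valuesAt V x) + 1 = finrank K E) {g : Dual K E}
    (hg : g ≠ 0) (h : ∀ M ∈ V, g (M x) = 0) : LinearMap.ker g = valuesAt V x := by
  refine (eq_of_le_of_finrank_le ?_ ?_).symm
  · intro w hw
    obtain ⟨M, hM, rfl⟩ := mem_valuesAt.1 hw
    exact h M hM
  · have := finrank_lt (s := LinearMap.ker g) (fun h => hg (LinearMap.ker_eq_top.1 h))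
    omega

theorem exists_ker_eq_valuesAt {x : E} (hx : finrank K (valuesAt V x) + 1 = finrank K E) :
    ∃ g : Dual K E, LinearMap.ker g = valuesAt V x := by
  obtain ⟨g, hg, h⟩ := exists_le_ker_of_lt_top (valuesAt V x) (lt_top_iff_ne_top.2 fun h => by
    rw [h, finrank_top] at hx
    omega)
  exact ⟨g, ker_eq_valuesAt hx hg fun M hM => h (mem_valuesAt.2 ⟨M, hM, rfl⟩)⟩

theorem ActsIrreducibly.finrank_valuesAt {t : K} (ht₀ : t ≠ 0) (ht₁ : t ≠ 1)
    (hirr : ActsIrreducibly V) (hV : FixedPointFree V) (hmax : HasMaximalDim V) {x : E}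
    (hx : x ≠ 0) : finrank K (valuesAt V x) + 1 = finrank K E :=
  hmax.finrank_valuesAt hV (by rwa [hirr.rankOneSpan_eq_bot ht₀ ht₁ hV hmax, mem_bot])

theorem ActsIrreducibly.valuesAt_ne {t : K} (ht₀ : t ≠ 0) (ht₁ : t ≠ 1)
    (hirr : ActsIrreducibly V) (hV : FixedPointFree V) (hmax : HasMaximalDim V) {x y : E}
    (hxy : LinearIndependent K ![x, y]) : valuesAt V x ≠ valuesAt V y := by
  intro heq
  have hx0 : x ≠ 0 := hxy.ne_zero 0
  have hxn := hirr.finrank_valuesAt ht₀ ht₁ hV hmax hx0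
  obtain ⟨ψ, hψ⟩ := exists_ker_eq_valuesAt hxn
  have hψx : ψ x ≠ 0 := fun h => hV.notMem_valuesAt hx0 (hψ ▸ LinearMap.mem_ker.2 h)
  have hψ0 : ψ ≠ 0 := by
    rintro rfl
    exact hψx rfl
  let Θ : V →ₗ[K] Dual K E :=
    { toFun := fun M => ψ ∘ₗ M.1
      map_add' := fun M N => LinearMap.comp_add _ _ _
      map_smul' := fun c M => LinearMap.comp_smul _ _ _ }
  have hmem : ∀ M ∈ LinearMap.ker Θ, ∀ z, M.1 z ∈ LinearMap.ker ψ := fun M hM z =>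
    LinearMap.congr_fun (LinearMap.mem_ker.1 hM) z
  let Φ : LinearMap.ker Θ →ₗ[K] End K (LinearMap.ker ψ) :=
    { toFun := fun M => M.1.1.restrict fun z _ => hmem M.1 M.2 z
      map_add' := fun M N => rfl
      map_smul' := fun c M => rfl }
  have hΦ : FixedPointFree (LinearMap.range Φ) := by
    rintro _ ⟨M, rfl⟩ z hz
    exact Subtype.ext (hV M.1.1 M.1.2 z (congrArg Subtype.val hz))
  have hinj : Function.Injective Φ := by
    rw [injective_iff_map_eq_zero]
    rintro ⟨M, hM⟩ h
    have hM0 : ∀ z, ψ z = 0 → M.1 z = 0 := fun z hz =>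
      congrArg Subtype.val (LinearMap.congr_fun h ⟨z, hz⟩)
    have hMψ : ∀ z, ψ z • M.1 x = ψ x • M.1 z := fun z => by
      have := hM0 (ψ z • x - ψ x • z) (by simp [mul_comm])
      rw [map_sub, map_smul, map_smul] at this
      exact sub_eq_zero.1 this
    have hMx : M.1 x = 0 := by
      refine hirr.eq_zero_of_smulRight_mem ht₀ ht₁ hV hmax hψ0 (f := ψ) ?_
      have : ψ.smulRight (M.1 x) = ψ x • M.1 := LinearMap.ext hMψ
      rw [this]
      exact V.smul_mem _ M.2
    refine Subtype.ext (Subtype.ext (LinearMap.ext fun z => ?_))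
    have := hMψ z
    rw [hMx, smul_zero] at this
    exact (smul_eq_zero.1 this.symm).resolve_left hψx
  have hrange : LinearMap.range Θ ≤ (span K (Set.range ![x, y])).dualAnnihilator := by
    rintro _ ⟨M, rfl⟩
    rw [mem_dualAnnihilator]
    intro w hw
    induction hw using span_induction with
    | mem w hw =>
      obtain ⟨i, rfl⟩ := hw
      fin_cases i
      · exact apply_eq_zero_of_ker_eq hψ M.2
      · exact apply_eq_zero_of_ker_eq (hψ.trans heq) M.2
    | zero => exact map_zero _
    | add a b _ _ h₁ h₂ => rw [map_add, h₁, h₂, add_zero]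
    | smul c a _ h => rw [map_smul, h, smul_zero]
  have d₁ := finrank_mono hrange
  have d₂ := Subspace.finrank_add_finrank_dualAnnihilator_eq (span K (Set.range ![x, y]))
  rw [finrank_span_eq_card hxy, Fintype.card_fin] at d₂
  have d₃ := Θ.finrank_range_add_finrank_ker
  have d₄ := LinearMap.finrank_range_of_inj hinj
  have d₅ := hΦ.finrank_le
  have d₆ : finrank K (LinearMap.ker ψ) = finrank K (valuesAt V x) := by rw [hψ]
  rw [d₄, d₆] at d₅
  rw [HasMaximalDim, ← hxn] at hmax
  rw [← hxn] at d₂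
  nlinarith

/-- For independent `x` and `y`, the forms `g` and `h` annihilating `V x` and `V y` can be rescaled
so that they are compatible with a bilinear form `b` such that every `b (x, M x)` vanishes. -/
theorem ActsIrreducibly.exists_add_mul_eq_zero {t : K} (ht₀ : t ≠ 0) (ht₁ : t ≠ 1)
    (hirr : ActsIrreducibly V) (hV : FixedPointFree V) (hmax : HasMaximalDim V) {x y : E}
    (hxy : LinearIndependent K ![x, y]) {g h : Dual K E} (hg : LinearMap.ker g = valuesAt V x)
    (hh : LinearMap.ker h = valuesAt V y) :
    ∃ c : K, c ≠ 0 ∧ ∀ M ∈ V, g (M y) + c * h (M x) = 0 := by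
  have hx0 : x ≠ 0 := hxy.ne_zero 0
  have hy0 : y ≠ 0 := hxy.ne_zero 1
  have hbot := hirr.rankOneSpan_eq_bot ht₀ ht₁ hV hmax
  have hxC : x ∉ rankOneSpan V := by rwa [hbot, mem_bot]
  have hyC : y ∉ rankOneSpan V := by rwa [hbot, mem_bot]
  have hxn := hmax.finrank_valuesAt hV hxC
  have hyn := hmax.finrank_valuesAt hV hyC
  have hne := hirr.valuesAt_ne ht₀ ht₁ hV hmax hxy
  have hquot : (K ∙ y).mkQ x ∉ rankOneSpan (descent V y) := by
    rw [(hirr.on_descent ht₀ ht₁ hV hmax hyC).rankOneSpan_eq_bot ht₀ ht₁ hV.on_descent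
      (hmax.on_descent hV hyC), mem_bot, mkQ_apply, Quotient.mk_eq_zero, mem_span_singleton]
    rintro ⟨a, rfl⟩
    have := LinearIndependent.pair_iff.1 hxy 1 (-a) (by simp)
    exact one_ne_zero this.1
  have hinf : valuesAt (vanishingAt V y) x = valuesAt V x ⊓ valuesAt V y := by
    refine eq_of_le_of_finrank_le ?_ ?_
    · intro w hw
      obtain ⟨M, hM, rfl⟩ := mem_valuesAt.1 hw
      rw [mem_vanishingAt] at hM
      exact ⟨mem_valuesAt.2 ⟨M, hM.1, rfl⟩,
        hmax.apply_mem_valuesAt ht₀ ht₁ hV hyC hM.1 hM.2 x⟩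
    · have h₁ := finrank_le_finrank_valuesAt_vanishingAt hV hmax hyC hquot
      have h₂ : valuesAt V x ⊓ valuesAt V y < valuesAt V x := by
        refine lt_of_le_of_ne inf_le_left fun h => hne ?_
        exact eq_of_le_of_finrank_le (inf_eq_left.1 h) (by omega)
      have h₃ := finrank_lt_finrank_of_lt h₂
      omega
  have hker : ∀ M ∈ V, h (M x) = 0 → g (M y) = 0 := by
    intro M hM hMx
    have : M x ∈ valuesAt (vanishingAt V y) x := by
      rw [hinf, ← hh]
      exact ⟨mem_valuesAt.2 ⟨M, hM, rfl⟩, hMx⟩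
    obtain ⟨N, hN, hNx⟩ := mem_valuesAt.1 this
    rw [mem_vanishingAt] at hN
    have := hmax.apply_mem_valuesAt ht₀ ht₁ hV hxC (V.sub_mem hM hN.1) (by simp [hNx]) y
    rw [← hg, LinearMap.sub_apply, hN.2, sub_zero] at this
    exact this
  let G : V →ₗ[K] K := g ∘ₗ (LinearMap.applyₗ y).domRestrict V
  let H : V →ₗ[K] K := h ∘ₗ (LinearMap.applyₗ x).domRestrict V
  obtain ⟨c, hc⟩ : ∃ c : K, c • H = G := by
    rw [← mem_span_singleton]
    have := mem_span_of_iInf_ker_le_ker (L := fun _ : Unit => H) (K := G) (by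
      rw [iInf_const]
      exact fun M hM => hker M.1 M.2 hM)
    simpa using this
  have hcM : ∀ M ∈ V, c * h (M x) = g (M y) := fun M hM => LinearMap.congr_fun hc ⟨M, hM⟩
  refine ⟨-c, ?_, fun M hM => by rw [← hcM M hM]; ring⟩
  rw [neg_ne_zero]
  rintro rfl
  refine hne ?_
  rw [← hg]
  refine ker_eq_valuesAt hyn ?_ fun M hM => by rw [← hcM M hM, zero_mul]
  rintro rfl
  rw [LinearMap.ker_zero] at hg
  exact hV.valuesAt_ne_top hx0 hg.symm

theorem ActsIrreducibly.add_eq_zero_of_linearIndependent {t : K} (ht₀ : t ≠ 0) (ht₁ : t ≠ 1)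
    (hirr : ActsIrreducibly V) (hV : FixedPointFree V) (hmax : HasMaximalDim V) {x y z : E}
    (hxyz : LinearIndependent K ![x, y, z]) {f g h : Dual K E}
    (hf : LinearMap.ker f = valuesAt V x) (hg : LinearMap.ker g = valuesAt V y)
    (hh : LinearMap.ker h = valuesAt V z) (hfg : ∀ M ∈ V, f (M y) + g (M x) = 0)
    (hfh : ∀ M ∈ V, f (M z) + h (M x) = 0) {M : End K E} (hM : M ∈ V) :
    g (M z) + h (M y) = 0 := by
  have hli : ∀ a b c : K, a • x + b • y + c • z = 0 → a = 0 ∧ b = 0 ∧ c = 0 := by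
    intro a b c habc
    have := Fintype.linearIndependent_iff.1 hxyz ![a, b, c]
      (by simpa [Fin.sum_univ_three] using habc)
    exact ⟨this 0, this 1, this 2⟩
  have hpair : ∀ a b : K, (a ≠ 0 ∨ b ≠ 0) → LinearIndependent K ![a • x + b • y, z] := by
    intro a b hab
    rw [LinearIndependent.pair_iff]
    intro p q hpq
    obtain ⟨h₁, h₂, h₃⟩ := hli (p * a) (p * b) q (by rw [← hpq]; module)
    refine ⟨?_, h₃⟩
    rcases hab with ha | hb
    exacts [(mul_eq_zero.1 h₁).resolve_right ha, (mul_eq_zero.1 h₂).resolve_right hb]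
  have hyz : LinearIndependent K ![y, z] := by simpa using hpair 0 1 (by simp)
  have hxyz' : LinearIndependent K ![x + y, z] := by simpa using hpair 1 1 (by simp)
  have hxy : LinearIndependent K ![x, y] := by
    rw [LinearIndependent.pair_iff]
    intro p q hpq
    obtain ⟨h₁, h₂, -⟩ := hli p q 0 (by simpa using hpq)
    exact ⟨h₁, h₂⟩
  obtain ⟨c, hc0, hc⟩ := hirr.exists_add_mul_eq_zero ht₀ ht₁ hV hmax hyz hg hh
  have hfg' : LinearMap.ker (f + g) = valuesAt V (x + y) := by
    have hxy0 : x + y ≠ 0 := hxyz'.ne_zero 0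
    refine ker_eq_valuesAt (hirr.finrank_valuesAt ht₀ ht₁ hV hmax hxy0) ?_ ?_
    · intro h0
      refine hirr.valuesAt_ne ht₀ ht₁ hV hmax hxy ?_
      rw [← hf, ← hg, eq_neg_of_add_eq_zero_left h0, LinearMap.ker_neg]
    · intro M hM
      have h₁ := hfg M hM
      have h₂ := apply_eq_zero_of_ker_eq hf hM
      have h₃ := apply_eq_zero_of_ker_eq hg hM
      simp only [LinearMap.add_apply, map_add]
      linear_combination h₁ + h₂ + h₃
  obtain ⟨d, hd0, hd⟩ := hirr.exists_add_mul_eq_zero ht₀ ht₁ hV hmax hxyz' hfg' hh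
  have hw : ∀ M ∈ V, h (M ((d - 1) • x + (d - c) • y)) = 0 := by
    intro M hM
    have h₁ := hc M hM
    have h₂ := hd M hM
    have h₃ := hfh M hM
    simp only [LinearMap.add_apply, map_add, map_smul, smul_eq_mul] at h₂ ⊢
    linear_combination h₂ - h₁ - h₃
  have hcd : ¬ (d - 1 ≠ 0 ∨ d - c ≠ 0) := by
    intro hne
    have hli' := hpair _ _ hne
    have hw0 : (d - 1) • x + (d - c) • y ≠ 0 := hli'.ne_zero 0
    have hz0 : z ≠ 0 := hli'.ne_zero 1
    refine hirr.valuesAt_ne ht₀ ht₁ hV hmax hli' ?_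
    rw [← hh]
    refine (ker_eq_valuesAt (hirr.finrank_valuesAt ht₀ ht₁ hV hmax hw0) ?_ hw).symm
    rintro rfl
    rw [LinearMap.ker_zero] at hh
    exact hV.valuesAt_ne_top hz0 hh.symm
  push Not at hcd
  have hc1 : c = 1 := by linear_combination hcd.1 - hcd.2
  simpa [hc1] using hc M hM

theorem ActsIrreducibly.exists_bilinear {t : K} (ht₀ : t ≠ 0) (ht₁ : t ≠ 1)
    (hirr : ActsIrreducibly V) (hV : FixedPointFree V) (hmax : HasMaximalDim V) :
    ∃ b : E →ₗ[K] Dual K E, (∀ x, x ≠ 0 → b x x ≠ 0) ∧ ∀ M ∈ V, ∀ x, b x (M x) = 0 := by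
  cases subsingleton_or_nontrivial E with
  | inl hs => exact ⟨0, fun x hx => absurd (Subsingleton.elim x 0) hx, by simp⟩
  | inr hnt =>
  let e := finBasis K E
  have : Nonempty (Fin (finrank K E)) := e.index_nonempty
  obtain ⟨o⟩ := this
  have hen := fun i => hirr.finrank_valuesAt ht₀ ht₁ hV hmax (e.ne_zero i)
  obtain ⟨f, hf⟩ := exists_ker_eq_valuesAt (hen o)
  have hpair : ∀ i j, i ≠ j → LinearIndependent K ![e i, e j] := by
    intro i j hij
    have := e.linearIndependent.comp ![i, j] (by
      intro a b
      fin_cases a <;> fin_cases b <;> simp [hij, hij.symm])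
    convert this using 1
    ext a
    fin_cases a <;> rfl
  have htriple : ∀ i j, i ≠ j → i ≠ o → j ≠ o → LinearIndependent K ![e o, e i, e j] := by
    intro i j hij hi hj
    have := e.linearIndependent.comp ![o, i, j] (by
      intro a b
      fin_cases a <;> fin_cases b <;> simp [hij, hij.symm, hi, hi.symm, hj, hj.symm])
    convert this using 1
    ext a
    fin_cases a <;> rfl
  have hex : ∀ i, ∃ g : Dual K E, LinearMap.ker g = valuesAt V (e i) ∧ (i = o → g = f) ∧
      (i ≠ o → ∀ M ∈ V, f (M (e i)) + g (M (e o)) = 0) := by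
    intro i
    by_cases hi : i = o
    · subst hi
      exact ⟨f, hf, fun _ => rfl, fun h => absurd rfl h⟩
    · obtain ⟨g, hg⟩ := exists_ker_eq_valuesAt (hen i)
      obtain ⟨c, hc0, hc⟩ := hirr.exists_add_mul_eq_zero ht₀ ht₁ hV hmax
        (hpair o i (Ne.symm hi)) hf hg
      exact ⟨c • g, by rw [LinearMap.ker_smul _ _ hc0, hg], fun h => absurd h hi,
        fun _ M hM => hc M hM⟩
  choose g hg hgo hgi using hex
  have hsymm : ∀ M ∈ V, ∀ i j, g i (M (e j)) + g j (M (e i)) = 0 := by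
    intro M hM i j
    by_cases hij : i = j
    · subst hij
      rw [apply_eq_zero_of_ker_eq (hg i) hM, add_zero]
    by_cases hi : i = o
    · rw [hgo i hi, hi]
      exact hgi j (fun h => hij (hi.trans h.symm)) M hM
    by_cases hj : j = o
    · rw [hgo j hj, hj, add_comm]
      exact hgi i hi M hM
    exact hirr.add_eq_zero_of_linearIndependent ht₀ ht₁ hV hmax (htriple i j hij hi hj) hf (hg i)
      (hg j) (hgi i hi) (hgi j hj) hM
  let b : E →ₗ[K] Dual K E := e.constr K g
  have hb : ∀ i, b (e i) = g i := fun i => e.constr_basis K g i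
  have hskew : ∀ M ∈ V, ∀ x y, b x (M y) + b y (M x) = 0 := by
    intro M hM x y
    have : b.compl₂ M + (b.compl₂ M).flip = 0 := by
      refine e.ext fun i => e.ext fun j => ?_
      simpa [hb] using hsymm M hM i j
    simpa using LinearMap.congr_fun₂ this x y
  have halt : ∀ M ∈ V, ∀ x, b x (M x) = 0 := by
    intro M hM x
    have hx : x ∈ span K (Set.range e) := e.span_eq ▸ mem_top
    induction hx using span_induction with
    | mem x hx =>
      obtain ⟨i, rfl⟩ := hx
      rw [hb]
      exact apply_eq_zero_of_ker_eq (hg i) hM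
    | zero => simp
    | add x y _ _ hx hy =>
      have := hskew M hM x y
      simp only [map_add, LinearMap.add_apply]
      linear_combination this + hx + hy
    | smul c x _ hx => simp [hx]
  have hf0 : f ≠ 0 := by
    rintro rfl
    rw [LinearMap.ker_zero] at hf
    exact hV.valuesAt_ne_top (e.ne_zero o) hf.symm
  refine ⟨b, fun x hx hbx => ?_, halt⟩
  have hxn := hirr.finrank_valuesAt ht₀ ht₁ hV hmax hx
  by_cases hb0 : b x = 0
  · have heq : valuesAt V (e o) = valuesAt V x := by
      rw [← hf]
      refine ker_eq_valuesAt hxn hf0 fun M hM => ?_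
      have := hskew M hM x (e o)
      rwa [hb0, LinearMap.zero_apply, zero_add, hb, hgo o rfl] at this
    have hdep : ¬ LinearIndependent K ![e o, x] := fun h =>
      hirr.valuesAt_ne ht₀ ht₁ hV hmax h heq
    rw [LinearIndependent.pair_iff' (e.ne_zero o)] at hdep
    push Not at hdep
    obtain ⟨a, rfl⟩ := hdep
    rw [map_smul, hb, hgo o rfl, smul_eq_zero] at hb0
    rcases hb0 with rfl | h
    exacts [hx (zero_smul _ _), hf0 h]
  · have := ker_eq_valuesAt hxn hb0 fun M hM => halt M hM x
    exact hV.notMem_valuesAt hx (this ▸ LinearMap.mem_ker.2 hbx)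

end TrivialSpectrumSpaces

section AlternateMatrices

open Module

variable {K : Type*} [Field K] {n : ℕ}

theorem mem_altSet_iff {A : Matrix (Fin n) (Fin n) K} :
    A ∈ altSet K n ↔ (∀ i, A i i = 0) ∧ ∀ i j, A i j + A j i = 0 := by
  constructor
  · intro h
    have hdiag : ∀ i, A i i = 0 := fun i => by simpa using h (Pi.single i 1)
    refine ⟨hdiag, fun i j => ?_⟩
    have := h (Pi.single i 1 + Pi.single j 1)
    simpa [mulVec_add, dotProduct_add, hdiag, add_comm] using this
  · rintro ⟨hdiag, hskew⟩ X
    simp only [dotProduct, mulVec, Finset.mul_sum]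
    rw [← Fintype.sum_prod_type' fun i j => X i * (A i j * X j)]
    refine Finset.sum_involution (fun p _ => p.swap) ?_ ?_ (by simp) (by simp)
    · rintro ⟨i, j⟩ -
      simp only [Prod.swap_prod_mk]
      linear_combination X i * X j * hskew i j
    · rintro ⟨i, j⟩ - h heq
      obtain rfl : j = i := congrArg Prod.fst heq
      exact h (by simp [hdiag])

variable (K n) in
/-- The subspace of alternate matrices. -/
def altSubmodule : Submodule K (Matrix (Fin n) (Fin n) K) where
  carrier := altSet K n
  zero_mem' X := by simp
  add_mem' hA hB X := by rw [add_mulVec, dotProduct_add, hA X, hB X, add_zero]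
  smul_mem' c A hA X := by rw [smul_mulVec, dotProduct_smul, hA X, smul_zero]

variable (K n) in
/-- The entries above the diagonal of an alternate matrix. -/
def upperEntries : altSubmodule K n →ₗ[K] ((Σ j : Fin n, Fin j) → K) where
  toFun A p := A.1 (p.2.castLE p.1.2.le) p.1
  map_add' _ _ := rfl
  map_smul' _ _ := rfl

variable (K n) in
theorem upperEntries_bijective : Function.Bijective (upperEntries K n) := by
  constructor
  · rw [injective_iff_map_eq_zero]
    rintro ⟨A, hA⟩ h
    obtain ⟨hdiag, hskew⟩ := mem_altSet_iff.1 hA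
    have hlt : ∀ i j, i < j → A i j = 0 := fun i j hij => congrFun h ⟨j, ⟨i, hij⟩⟩
    refine Subtype.ext (Matrix.ext fun i j => ?_)
    rcases lt_trichotomy i j with hij | rfl | hij
    · exact hlt i j hij
    · exact hdiag i
    · have := hskew i j
      rwa [hlt j i hij, add_zero] at this
  · intro f
    let A : Matrix (Fin n) (Fin n) K := Matrix.of fun i j =>
      if h : i < j then f ⟨j, ⟨i, h⟩⟩ else if h : j < i then -f ⟨i, ⟨j, h⟩⟩ else 0
    have hA : A ∈ altSet K n := by
      rw [mem_altSet_iff]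
      refine ⟨fun i => by simp [A], fun i j => ?_⟩
      rcases lt_trichotomy i j with hij | rfl | hij
      · simp [A, hij, hij.not_gt]
      · simp [A]
      · simp [A, hij, hij.not_gt]
    refine ⟨⟨A, hA⟩, funext fun ⟨j, i⟩ => ?_⟩
    have hij : i.castLE j.2.le < j := i.2
    exact dif_pos hij

variable (K n) in
theorem finrank_altSubmodule : finrank K (altSubmodule K n) = n * (n - 1) / 2 := by
  rw [(LinearEquiv.ofBijective _ (upperEntries_bijective K n)).finrank_eq,
    finrank_fintype_fun_eq_card, Fintype.card_sigma]
  simp only [Fintype.card_fin]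
  rw [Fin.sum_univ_eq_sum_range (fun i => i) n, Finset.sum_range_id]

theorem vecMulVec_sub_vecMulVec_mem_altSet (u v : Fin n → K) :
    vecMulVec u v - vecMulVec v u ∈ altSet K n := by
  intro X
  simp only [sub_mulVec, vecMulVec_mulVec, dotProduct_sub]
  simp [dotProduct_comm X, mul_comm]

variable {V : Submodule K (Matrix (Fin n) (Fin n) K)} {P : Matrix (Fin n) (Fin n) K}

theorem nonIsotropic.trivialSpectrum (hiso : nonIsotropic P) :
    TrivialSpectrum ((fun A => P * A) '' altSet K n) := by
  rintro _ ⟨A, hA, rfl⟩ X hX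
  rw [← mulVec_mulVec] at hX
  have h : A.mulVec X = 0 := by
    by_contra hne
    refine hiso _ hne ?_
    rw [hX, dotProduct_comm]
    exact hA X
  rw [← hX, h, mulVec_zero]

theorem nonIsotropic.irreducibleMatSpace (hiso : nonIsotropic P) :
    IrreducibleMatSpace ((fun A => P * A) '' altSet K n) := by
  intro W hW
  by_contra! hne
  obtain ⟨x, hxW, hx⟩ := W.ne_bot_iff.1 hne.1
  obtain ⟨φ, hφ, hφW⟩ := W.exists_le_ker_of_lt_top (lt_top_iff_ne_top.2 hne.2)
  obtain ⟨y, rfl⟩ := (dotProductEquiv K (Fin n)).surjective φ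
  have hyW : ∀ w ∈ W, y ⬝ᵥ w = 0 := fun w hw => hφW hw
  obtain ⟨k, hk⟩ : ∃ k, x k ≠ 0 := Function.ne_iff.1 hx
  have hy : y ≠ 0 := by
    rintro rfl
    exact hφ (map_zero _)
  refine hiso y hy ?_
  have h := hyW _ (hW _ ⟨_, vecMulVec_sub_vecMulVec_mem_altSet y (Pi.single k 1), rfl⟩ x hxW)
  simpa [← mulVec_mulVec, sub_mulVec, vecMulVec_mulVec, mulVec_smul, hyW x hxW, hk] using h

theorem finrank_of_eq_image_altSet (hP : IsUnit P)
    (hV : (V : Set (Matrix (Fin n) (Fin n) K)) = (fun A => P * A) '' altSet K n) :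
    finrank K V = n * (n - 1) / 2 := by
  have : V = (altSubmodule K n).map (LinearMap.mulLeft K P) := SetLike.coe_injective hV
  rw [this, ← finrank_altSubmodule K n]
  exact (Submodule.equivMapOfInjective _ (fun A B h => hP.mul_left_cancel h) _).finrank_eq.symm

theorem exists_eq_image_altSet {t : K} (ht₀ : t ≠ 0) (ht₁ : t ≠ 1)
    (hspec : TrivialSpectrum (V : Set (Matrix (Fin n) (Fin n) K)))
    (hdim : finrank K V = n * (n - 1) / 2)
    (hirr : IrreducibleMatSpace (V : Set (Matrix (Fin n) (Fin n) K))) :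
    ∃ P : Matrix (Fin n) (Fin n) K, IsUnit P ∧ nonIsotropic P ∧
      (V : Set (Matrix (Fin n) (Fin n) K)) = (fun A => P * A) '' altSet K n := by
  let V' : Submodule K (End K (Fin n → K)) := V.map (toLin' (R := K)).toLinearMap
  have hmem : ∀ M ∈ V, toLin' M ∈ V' := fun M hM => Submodule.mem_map_of_mem hM
  have hfree : FixedPointFree V' := by
    rintro _ ⟨M, hM, rfl⟩ x hx
    exact hspec M hM x hx
  have hmax : HasMaximalDim V' := by
    have h := Nat.div_mul_cancel (Nat.even_mul_pred_self n).two_dvd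
    have h' : finrank K V' = finrank K V := LinearEquiv.finrank_map_eq _ _
    rw [HasMaximalDim, h', hdim, finrank_fin_fun, mul_comm, h]
    cases n <;> simp; ring
  have hirr' : ActsIrreducibly V' := fun W hW => hirr W fun M hM => hW _ (hmem M hM)
  obtain ⟨b, hb, hbV⟩ := hirr'.exists_bilinear ht₀ ht₁ hfree hmax
  let Q : Matrix (Fin n) (Fin n) K := LinearMap.toMatrix₂' K b
  have hQ : ∀ X Y, X ⬝ᵥ Q.mulVec Y = b X Y := fun X Y => by
    rw [← Matrix.toLinearMap₂'_apply' Q X Y, Matrix.toLinearMap₂'_toMatrix']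
  have hQu : IsUnit Q := by
    rw [← mulVec_injective_iff_isUnit]
    refine (injective_iff_map_eq_zero (Matrix.mulVecLin Q)).2 fun X hX => ?_
    by_contra hne
    refine hb X hne ?_
    rw [← hQ]
    rw [mulVecLin_apply] at hX
    rw [hX, dotProduct_zero]
  have hdet := Q.isUnit_iff_isUnit_det.1 hQu
  have hPu : IsUnit Q⁻¹ := Q.isUnit_nonsing_inv_iff.2 hQu
  refine ⟨Q⁻¹, hPu, ?_, ?_⟩
  · intro X hX h
    have hQX : Q.mulVec (Q⁻¹.mulVec X) = X := by
      rw [mulVec_mulVec, Q.mul_nonsing_inv hdet, one_mulVec]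
    refine hb (Q⁻¹.mulVec X) (fun h0 => hX ?_) ?_
    · rw [← hQX, h0, mulVec_zero]
    · rw [← hQ, hQX, dotProduct_comm, h]
  · have hle : V ≤ (altSubmodule K n).map (LinearMap.mulLeft K Q⁻¹) := by
      intro M hM
      refine ⟨Q * M, fun X => ?_, Q.nonsing_inv_mul_cancel_left M hdet⟩
      rw [← mulVec_mulVec, hQ]
      exact hbV _ (hmem M hM) X
    have heq := Submodule.eq_of_le_of_finrank_eq hle
      (hdim.trans (finrank_of_eq_image_altSet hPu rfl).symm)
    exact congrArg SetLike.coe heq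

theorem exists_ne_zero_ne_one (hK : 3 ≤ Cardinal.mk K) : ∃ t : K, t ≠ 0 ∧ t ≠ 1 :=
  Cardinal.exists_ne_ne_of_three_le hK 0 1

end AlternateMatrices

/-- Assume `|K| ≥ 3`.  A linear subspace `V` of `M_n(K)` is an irreducible maximal linear
subspace with a trivial spectrum if and only if `V = P·Alt_n(K)` for some non-isotropic
invertible matrix `P`. -/
theorem irreducible_maximal_iff (K : Type*) [Field K] (hK : 3 ≤ Cardinal.mk K)
    (n : ℕ) (hn : 0 < n) (V : Submodule K (Matrix (Fin n) (Fin n) K)) :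
    (TrivialSpectrum (V : Set (Matrix (Fin n) (Fin n) K)) ∧
      Module.finrank K V = n * (n - 1) / 2 ∧
      IrreducibleMatSpace (V : Set (Matrix (Fin n) (Fin n) K))) ↔
    ∃ P : Matrix (Fin n) (Fin n) K, IsUnit P ∧ nonIsotropic P ∧
      (V : Set (Matrix (Fin n) (Fin n) K)) = (fun A => P * A) '' altSet K n := by
  constructor
  · rintro ⟨hspec, hdim, hirr⟩
    obtain ⟨t, ht₀, ht₁⟩ := exists_ne_zero_ne_one hK
    exact exists_eq_image_altSet ht₀ ht₁ hspec hdim hirr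
  · rintro ⟨P, hP, hiso, hV⟩
    refine ⟨?_, finrank_of_eq_image_altSet hP hV, ?_⟩
    · rw [hV]
      exact hiso.trivialSpectrum
    · rw [hV]
      exact hiso.irreducibleMatSpace
end
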